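/- Let w : ℝ³ → ℝ be a smooth solution of the PKP equation and let f, g, h, k, ℓ : ℝ → ℝ be smooth. Define Q : ℝ³ → ℝ by Q = f(t)∂_t w + ((2/3)y f'(t) + g(t))∂_y w + ((1/3)x f'(t) + (2/9)y² f''(t) + (2/3)y g'(t) + h(t))∂ₓ w + (1/3)w f'(t) + (1/9)x² f''(t) + (4/27)x y² f'''(t) + (4/243)y⁴ f''''(t) + (4/9)x y g''(t) + (8/81)y³ g'''(t) + (2/3)x h'(t) + (4/9)y² h''(t) − y k(t) − ℓ(t). Then Q is a symmetry characteristic of PKP at w, i.e. Q satisfies the linearized PKP equation. -/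

import Mathlib

noncomputable section

/-- Partial derivative in the first variable `x`. -/
def dx (w : ℝ → ℝ → ℝ → ℝ) : ℝ → ℝ → ℝ → ℝ :=
  fun x y t => deriv (fun s => w s y t) x

/-- Partial derivative in the second variable `y`. -/
def dy (w : ℝ → ℝ → ℝ → ℝ) : ℝ → ℝ → ℝ → ℝ :=
  fun x y t => deriv (fun s => w x s t) y

/-- Partial derivative in the third variable `t`. -/
def dt (w : ℝ → ℝ → ℝ → ℝ) : ℝ → ℝ → ℝ → ℝ :=
  fun x y t => deriv (fun s => w x y s) t

/-- Smoothness of a function of three real variables. -/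
def Smooth3 (w : ℝ → ℝ → ℝ → ℝ) : Prop :=
  ContDiff ℝ (⊤ : ℕ∞) (fun p : ℝ × ℝ × ℝ => w p.1 p.2.1 p.2.2)

/-- The potential Kadomtsev–Petviashvili equation. -/
def PKP (w : ℝ → ℝ → ℝ → ℝ) : Prop :=
  ∀ x y t, dx (dt w) x y t =
      (1/4) * dx (dx (dx (dx w))) x y t
    + (3/2) * dx w x y t * dx (dx w) x y t
    + (3/4) * dy (dy w) x y t

/-- The linearization of the PKP equation at a solution `w`. -/
def LinPKP (w Q : ℝ → ℝ → ℝ → ℝ) : Prop :=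
  ∀ x y t, dx (dt Q) x y t =
      (1/4) * dx (dx (dx (dx Q))) x y t
    + (3/2) * (dx Q x y t * dx (dx w) x y t + dx w x y t * dx (dx Q) x y t)
    + (3/4) * dy (dy Q) x y t

/-- The function `p ↦ w p.1 p.2.1 p.2.2` on the product space. -/
def uncurry3 (w : ℝ → ℝ → ℝ → ℝ) : ℝ × ℝ × ℝ → ℝ := fun p => w p.1 p.2.1 p.2.2

theorem Smooth3.contDiff {w : ℝ → ℝ → ℝ → ℝ} (hw : Smooth3 w) :
    ContDiff ℝ (⊤ : ℕ∞) (uncurry3 w) := hw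

theorem Smooth3.differentiable {w : ℝ → ℝ → ℝ → ℝ} (hw : Smooth3 w) :
    Differentiable ℝ (uncurry3 w) := hw.contDiff.differentiable (by simp)

theorem Smooth3.hasDerivAt_x {w : ℝ → ℝ → ℝ → ℝ} (hw : Smooth3 w) (x y t : ℝ) :
    HasDerivAt (fun s => w s y t) (fderiv ℝ (uncurry3 w) (x, y, t) (1, 0, 0)) x := by
  have hc := (hasDerivAt_id x).prodMk ((hasDerivAt_const x y).prodMk (hasDerivAt_const x t))
  have hd : HasFDerivAt (uncurry3 w) (fderiv ℝ (uncurry3 w) (x, y, t)) (x, y, t) :=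
    (hw.differentiable (x, y, t)).hasFDerivAt
  exact hd.comp_hasDerivAt x hc

theorem Smooth3.hasDerivAt_y {w : ℝ → ℝ → ℝ → ℝ} (hw : Smooth3 w) (x y t : ℝ) :
    HasDerivAt (fun s => w x s t) (fderiv ℝ (uncurry3 w) (x, y, t) (0, 1, 0)) y := by
  have hc := (hasDerivAt_const y x).prodMk ((hasDerivAt_id y).prodMk (hasDerivAt_const y t))
  have hd : HasFDerivAt (uncurry3 w) (fderiv ℝ (uncurry3 w) (x, y, t)) (x, y, t) :=
    (hw.differentiable (x, y, t)).hasFDerivAt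
  exact hd.comp_hasDerivAt y hc

theorem Smooth3.hasDerivAt_t {w : ℝ → ℝ → ℝ → ℝ} (hw : Smooth3 w) (x y t : ℝ) :
    HasDerivAt (fun s => w x y s) (fderiv ℝ (uncurry3 w) (x, y, t) (0, 0, 1)) t := by
  have hc := (hasDerivAt_const t x).prodMk ((hasDerivAt_const t y).prodMk (hasDerivAt_id t))
  have hd : HasFDerivAt (uncurry3 w) (fderiv ℝ (uncurry3 w) (x, y, t)) (x, y, t) :=
    (hw.differentiable (x, y, t)).hasFDerivAt
  exact hd.comp_hasDerivAt t hc

theorem Smooth3.uncurry3_dx {w : ℝ → ℝ → ℝ → ℝ} (hw : Smooth3 w) :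
    uncurry3 (dx w) = fun p => fderiv ℝ (uncurry3 w) p (1, 0, 0) :=
  funext fun p => (hw.hasDerivAt_x p.1 p.2.1 p.2.2).deriv

theorem Smooth3.dx {w : ℝ → ℝ → ℝ → ℝ} (hw : Smooth3 w) : Smooth3 (dx w) := by
  change ContDiff ℝ (⊤ : ℕ∞) (uncurry3 (_root_.dx w))
  rw [hw.uncurry3_dx]
  exact (hw.contDiff.fderiv_right (by simp)).clm_apply contDiff_const

theorem Smooth3.uncurry3_dy {w : ℝ → ℝ → ℝ → ℝ} (hw : Smooth3 w) :
    uncurry3 (dy w) = fun p => fderiv ℝ (uncurry3 w) p (0, 1, 0) :=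
  funext fun p => (hw.hasDerivAt_y p.1 p.2.1 p.2.2).deriv

theorem Smooth3.dy {w : ℝ → ℝ → ℝ → ℝ} (hw : Smooth3 w) : Smooth3 (dy w) := by
  change ContDiff ℝ (⊤ : ℕ∞) (uncurry3 (_root_.dy w))
  rw [hw.uncurry3_dy]
  exact (hw.contDiff.fderiv_right (by simp)).clm_apply contDiff_const

theorem Smooth3.uncurry3_dt {w : ℝ → ℝ → ℝ → ℝ} (hw : Smooth3 w) :
    uncurry3 (dt w) = fun p => fderiv ℝ (uncurry3 w) p (0, 0, 1) :=
  funext fun p => (hw.hasDerivAt_t p.1 p.2.1 p.2.2).deriv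

theorem Smooth3.dt {w : ℝ → ℝ → ℝ → ℝ} (hw : Smooth3 w) : Smooth3 (dt w) := by
  change ContDiff ℝ (⊤ : ℕ∞) (uncurry3 (_root_.dt w))
  rw [hw.uncurry3_dt]
  exact (hw.contDiff.fderiv_right (by simp)).clm_apply contDiff_const

/-- Directional derivatives of a smooth function commute. -/
theorem Smooth3.fderiv_fderiv_comm {w : ℝ → ℝ → ℝ → ℝ} (hw : Smooth3 w) (p a b : ℝ × ℝ × ℝ) :
    fderiv ℝ (fun q => fderiv ℝ (uncurry3 w) q a) p b =
      fderiv ℝ (fun q => fderiv ℝ (uncurry3 w) q b) p a := by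
  have hd : DifferentiableAt ℝ (fderiv ℝ (uncurry3 w)) p :=
    (hw.contDiff.fderiv_right (m := 1) (by norm_cast)).differentiable (by simp) p
  have hs : IsSymmSndFDerivAt ℝ (uncurry3 w) p :=
    hw.contDiff.contDiffAt.isSymmSndFDerivAt (by
      simp only [minSmoothness_of_isRCLikeNormedField]; norm_cast)
  rw [fderiv_clm_apply hd (differentiableAt_const a),
    fderiv_clm_apply hd (differentiableAt_const b)]
  simpa using hs b a

theorem dy_dx {w : ℝ → ℝ → ℝ → ℝ} (hw : Smooth3 w) : dy (dx w) = dx (dy w) := by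
  funext x y t
  refine (hw.dx.hasDerivAt_y x y t).deriv.trans
    (Eq.trans ?_ (hw.dy.hasDerivAt_x x y t).deriv.symm)
  rw [hw.uncurry3_dx, hw.uncurry3_dy]
  exact hw.fderiv_fderiv_comm _ _ _

theorem dt_dx {w : ℝ → ℝ → ℝ → ℝ} (hw : Smooth3 w) : dt (dx w) = dx (dt w) := by
  funext x y t
  refine (hw.dx.hasDerivAt_t x y t).deriv.trans
    (Eq.trans ?_ (hw.dt.hasDerivAt_x x y t).deriv.symm)
  rw [hw.uncurry3_dx, hw.uncurry3_dt]
  exact hw.fderiv_fderiv_comm _ _ _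

theorem dt_dy {w : ℝ → ℝ → ℝ → ℝ} (hw : Smooth3 w) : dt (dy w) = dy (dt w) := by
  funext x y t
  refine (hw.dy.hasDerivAt_t x y t).deriv.trans
    (Eq.trans ?_ (hw.dt.hasDerivAt_y x y t).deriv.symm)
  rw [hw.uncurry3_dy, hw.uncurry3_dt]
  exact hw.fderiv_fderiv_comm _ _ _

theorem Smooth3.add {u v : ℝ → ℝ → ℝ → ℝ} (hu : Smooth3 u) (hv : Smooth3 v) :
    Smooth3 (u + v) := ContDiff.add hu hv

theorem Smooth3.mul {u v : ℝ → ℝ → ℝ → ℝ} (hu : Smooth3 u) (hv : Smooth3 v) :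
    Smooth3 (u * v) := ContDiff.mul hu hv

theorem Smooth3.smul {u : ℝ → ℝ → ℝ → ℝ} (c : ℝ) (hu : Smooth3 u) :
    Smooth3 (c • u) := ContDiff.const_smul c hu

/-- The coordinate function `x`. -/
def coordX : ℝ → ℝ → ℝ → ℝ := fun x _ _ => x

/-- The coordinate function `y`. -/
def coordY : ℝ → ℝ → ℝ → ℝ := fun _ y _ => y

/-- A function of `t` viewed as a function of `(x, y, t)`. -/
def ofT (f : ℝ → ℝ) : ℝ → ℝ → ℝ → ℝ := fun _ _ t => f t

theorem smooth3_coordX : Smooth3 coordX := contDiff_fst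

theorem smooth3_coordY : Smooth3 coordY := contDiff_fst.comp contDiff_snd

theorem smooth3_ofT {f : ℝ → ℝ} (hf : ContDiff ℝ (⊤ : ℕ∞) f) : Smooth3 (ofT f) :=
  hf.comp (contDiff_snd.comp contDiff_snd)

theorem smooth3_one : Smooth3 1 := contDiff_const

theorem contDiff_top_deriv {f : ℝ → ℝ} (hf : ContDiff ℝ (⊤ : ℕ∞) f) :
    ContDiff ℝ (⊤ : ℕ∞) (deriv f) :=
  (contDiff_infty_iff_deriv.1 hf).2

theorem dx_add {u v : ℝ → ℝ → ℝ → ℝ} (hu : Smooth3 u) (hv : Smooth3 v) :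
    dx (u + v) = dx u + dx v := by
  funext x y t
  exact deriv_add (hu.hasDerivAt_x x y t).differentiableAt
    (hv.hasDerivAt_x x y t).differentiableAt

theorem dx_mul {u v : ℝ → ℝ → ℝ → ℝ} (hu : Smooth3 u) (hv : Smooth3 v) :
    dx (u * v) = dx u * v + u * dx v := by
  funext x y t
  exact deriv_mul (hu.hasDerivAt_x x y t).differentiableAt
    (hv.hasDerivAt_x x y t).differentiableAt

theorem dx_smul {u : ℝ → ℝ → ℝ → ℝ} (c : ℝ) (hu : Smooth3 u) :
    dx (c • u) = c • dx u := by
  funext x y t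
  exact deriv_const_smul c (hu.hasDerivAt_x x y t).differentiableAt

theorem dx_one : dx 1 = 0 := by
  funext x y t
  exact deriv_const _ _

theorem dx_coordX : dx coordX = 1 := by
  funext x y t
  exact deriv_id _

theorem dx_coordY : dx coordY = 0 := by
  funext x y t
  exact deriv_const _ _

theorem dx_ofT (f : ℝ → ℝ) : dx (ofT f) = 0 := by
  funext x y t
  exact deriv_const _ _

theorem dy_add {u v : ℝ → ℝ → ℝ → ℝ} (hu : Smooth3 u) (hv : Smooth3 v) :
    dy (u + v) = dy u + dy v := by
  funext x y t
  exact deriv_add (hu.hasDerivAt_y x y t).differentiableAt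
    (hv.hasDerivAt_y x y t).differentiableAt

theorem dy_mul {u v : ℝ → ℝ → ℝ → ℝ} (hu : Smooth3 u) (hv : Smooth3 v) :
    dy (u * v) = dy u * v + u * dy v := by
  funext x y t
  exact deriv_mul (hu.hasDerivAt_y x y t).differentiableAt
    (hv.hasDerivAt_y x y t).differentiableAt

theorem dy_smul {u : ℝ → ℝ → ℝ → ℝ} (c : ℝ) (hu : Smooth3 u) :
    dy (c • u) = c • dy u := by
  funext x y t
  exact deriv_const_smul c (hu.hasDerivAt_y x y t).differentiableAt

theorem dy_coordX : dy coordX = 0 := by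
  funext x y t
  exact deriv_const _ _

theorem dy_coordY : dy coordY = 1 := by
  funext x y t
  exact deriv_id _

theorem dy_ofT (f : ℝ → ℝ) : dy (ofT f) = 0 := by
  funext x y t
  exact deriv_const _ _

theorem dt_add {u v : ℝ → ℝ → ℝ → ℝ} (hu : Smooth3 u) (hv : Smooth3 v) :
    dt (u + v) = dt u + dt v := by
  funext x y t
  exact deriv_add (hu.hasDerivAt_t x y t).differentiableAt
    (hv.hasDerivAt_t x y t).differentiableAt

theorem dt_mul {u v : ℝ → ℝ → ℝ → ℝ} (hu : Smooth3 u) (hv : Smooth3 v) :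
    dt (u * v) = dt u * v + u * dt v := by
  funext x y t
  exact deriv_mul (hu.hasDerivAt_t x y t).differentiableAt
    (hv.hasDerivAt_t x y t).differentiableAt

theorem dt_smul {u : ℝ → ℝ → ℝ → ℝ} (c : ℝ) (hu : Smooth3 u) :
    dt (c • u) = c • dt u := by
  funext x y t
  exact deriv_const_smul c (hu.hasDerivAt_t x y t).differentiableAt

theorem dt_coordX : dt coordX = 0 := by
  funext x y t
  exact deriv_const _ _

theorem dt_coordY : dt coordY = 0 := by
  funext x y t
  exact deriv_const _ _

theorem dt_ofT (f : ℝ → ℝ) : dt (ofT f) = ofT (deriv f) := rfl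

/-- The PKP equation as an identity of functions. -/
theorem PKP.eq {w : ℝ → ℝ → ℝ → ℝ} (hsol : PKP w) :
    dx (dt w) = (1 / 4 : ℝ) • dx (dx (dx (dx w))) + (3 / 2 : ℝ) • (dx w * dx (dx w))
      + (3 / 4 : ℝ) • dy (dy w) := by
  funext x y t
  simp only [hsol x y t, Pi.add_apply, Pi.mul_apply, Pi.smul_apply, smul_eq_mul]
  ring

/-- The full point symmetry characteristic of the PKP equation. -/
theorem stmt1 (w : ℝ → ℝ → ℝ → ℝ) (hw : Smooth3 w) (hsol : PKP w)
    (f g h k l : ℝ → ℝ) (hf : ContDiff ℝ (⊤ : ℕ∞) f) (hg : ContDiff ℝ (⊤ : ℕ∞) g)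
    (hh : ContDiff ℝ (⊤ : ℕ∞) h) (hk : ContDiff ℝ (⊤ : ℕ∞) k) (hl : ContDiff ℝ (⊤ : ℕ∞) l) :
    LinPKP w (fun x y t =>
      f t * dt w x y t
      + ((2/3) * y * deriv f t + g t) * dy w x y t
      + ((1/3) * x * deriv f t + (2/9) * y ^ 2 * deriv (deriv f) t
          + (2/3) * y * deriv g t + h t) * dx w x y t
      + (1/3) * w x y t * deriv f t + (1/9) * x ^ 2 * deriv (deriv f) t
      + (4/27) * x * y ^ 2 * deriv (deriv (deriv f)) t
      + (4/243) * y ^ 4 * deriv (deriv (deriv (deriv f))) t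
      + (4/9) * x * y * deriv (deriv g) t
      + (8/81) * y ^ 3 * deriv (deriv (deriv g)) t
      + (2/3) * x * deriv h t + (4/9) * y ^ 2 * deriv (deriv h) t
      - y * k t - l t) := by
  have hQ : LinPKP w (ofT f * dt w
      + ((2 / 3 : ℝ) • (coordY * ofT (deriv f)) + ofT g) * dy w
      + ((1 / 3 : ℝ) • (coordX * ofT (deriv f))
          + (2 / 9 : ℝ) • (coordY * coordY * ofT (deriv (deriv f)))
          + (2 / 3 : ℝ) • (coordY * ofT (deriv g)) + ofT h) * dx w
      + (1 / 3 : ℝ) • (w * ofT (deriv f))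
      + (1 / 9 : ℝ) • (coordX * coordX * ofT (deriv (deriv f)))
      + (4 / 27 : ℝ) • (coordX * (coordY * coordY) * ofT (deriv (deriv (deriv f))))
      + (4 / 243 : ℝ) • (coordY * coordY * (coordY * coordY)
          * ofT (deriv (deriv (deriv (deriv f)))))
      + (4 / 9 : ℝ) • (coordX * coordY * ofT (deriv (deriv g)))
      + (8 / 81 : ℝ) • (coordY * coordY * coordY * ofT (deriv (deriv (deriv g))))
      + (2 / 3 : ℝ) • (coordX * ofT (deriv h))
      + (4 / 9 : ℝ) • (coordY * coordY * ofT (deriv (deriv h)))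
      + (-1 : ℝ) • (coordY * ofT k) + (-1 : ℝ) • ofT l) := by
    intro x y t
    have e := hsol x y t
    have ex := congrFun (congrFun (congrFun (congrArg dx hsol.eq) x) y) t
    have ey := congrFun (congrFun (congrFun (congrArg dy hsol.eq) x) y) t
    have et := congrFun (congrFun (congrFun (congrArg dt hsol.eq) x) y) t
    simp (disch := (repeat' first
        | assumption | exact smooth3_coordX | exact smooth3_coordY
        | exact smooth3_one | apply Smooth3.add | apply Smooth3.mul | apply Smooth3.smul
        | apply Smooth3.dx | apply Smooth3.dy | apply Smooth3.dt | apply smooth3_ofT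
        | apply contDiff_top_deriv)) only
      [dx_add, dy_add, dt_add, dx_mul, dy_mul, dt_mul, dx_smul, dy_smul, dt_smul,
      dy_dx, dt_dx, dt_dy,
      dx_one, dx_coordX, dy_coordX, dt_coordX, dx_coordY, dy_coordY, dt_coordY,
      dx_ofT, dy_ofT, dt_ofT,
      mul_zero, zero_mul, mul_one, one_mul, add_zero, zero_add, smul_zero] at ex ey et ⊢
    simp only [Pi.add_apply, Pi.mul_apply, Pi.smul_apply, smul_eq_mul, coordX, coordY, ofT,
      Pi.one_apply] at ex ey et ⊢
    linear_combination f t * et + (2 / 3 * y * deriv f t + g t) * ey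
      + (1 / 3 * x * deriv f t + 2 / 9 * y ^ 2 * deriv (deriv f) t
          + 2 / 3 * y * deriv g t + h t) * ex
      + 5 / 3 * deriv f t * e
  convert hQ using 1
  funext x y t
  simp only [Pi.add_apply, Pi.mul_apply, Pi.smul_apply, smul_eq_mul, coordX, coordY, ofT]
  ring
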